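/- Let R be a commutative ring. (i) For every a with a, 1−a ∈ R^×, the element ⟨a⟩ := [a] + [a^{-1}] of p(R) satisfies λ(⟨a⟩) = a ⊗ (−a) in (R^× ⊗ R^×)_σ; in particular ⟨a⟩ ∈ B'(R). (ii) For all a, b with a, 1−a, b, 1−b, 1−ab ∈ R^×, the element ⟨ab⟩ − ⟨a⟩ − ⟨b⟩ lies in the Bloch group B(R). -/

import Mathlib

/-- `R^× ⊗_ℤ R^×`: the tensor square of the (additively written) abelian group of
units of `R`. -/
abbrev TT (R : Type) [CommRing R] : Type :=
  TensorProduct ℤ (Additive Rˣ) (Additive Rˣ)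

/-- The elementary tensor `a ⊗ b` for units `a b : Rˣ`. -/
noncomputable def tmulU (R : Type) [CommRing R] (a b : Rˣ) : TT R :=
  TensorProduct.tmul ℤ (Additive.ofMul a) (Additive.ofMul b)

/-- The subgroup of `R^× ⊗ R^×` generated by the elements `a ⊗ b + b ⊗ a`. -/
noncomputable def sigmaSub (R : Type) [CommRing R] : AddSubgroup (TT R) :=
  AddSubgroup.closure {x | ∃ a b : Rˣ, x = tmulU R a b + tmulU R b a}

/-- `(R^× ⊗ R^×)_σ`. -/
abbrev Tsigma (R : Type) [CommRing R] : Type := TT R ⧸ sigmaSub R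

/-- Canonical projection onto `(R^× ⊗ R^×)_σ`. -/
noncomputable def clsS (R : Type) [CommRing R] : TT R →+ Tsigma R :=
  QuotientAddGroup.mk' _

/-- The subgroup of `R^× ⊗ R^×` generated by the elements `a ⊗ (-a)`. -/
noncomputable def sbarSub (R : Type) [CommRing R] : AddSubgroup (TT R) :=
  AddSubgroup.closure {x | ∃ a : Rˣ, x = tmulU R a (-a)}

/-- `(R^× ⊗ R^×)_σ̄`. -/
abbrev Tsigmabar (R : Type) [CommRing R] : Type := TT R ⧸ sbarSub R

/-- Canonical projection onto `(R^× ⊗ R^×)_σ̄`. -/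
noncomputable def clsSb (R : Type) [CommRing R] : TT R →+ Tsigmabar R :=
  QuotientAddGroup.mk' _

/-- The subgroup of `R^× ⊗ R^×` generated by the elements `a ⊗ (1-a)`
with `a`, `1-a` units. -/
noncomputable def k2Sub (R : Type) [CommRing R] : AddSubgroup (TT R) :=
  AddSubgroup.closure {x | ∃ a b : Rˣ, (b : R) = 1 - (a : R) ∧ x = tmulU R a b}

/-- The Milnor K-group `K_2^M(R)`. -/
abbrev K2M (R : Type) [CommRing R] : Type := TT R ⧸ k2Sub R

/-- Canonical projection onto `K_2^M(R)`; `clsK R (tmulU R a b)` is the symbol `{a, b}`. -/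
noncomputable def clsK (R : Type) [CommRing R] : TT R →+ K2M R :=
  QuotientAddGroup.mk' _
/-- The index set for the generators `[a]` of the pre-Bloch group: elements `a` of `R`
with `a` and `1 - a` units. -/
abbrev Wt (R : Type) [CommRing R] : Type := {a : R // IsUnit a ∧ IsUnit (1 - a)}

/-- The subgroup of relations of the pre-Bloch group: it is generated by the elements
`[a] - [b] + [b/a] - [(1-a⁻¹)/(1-b⁻¹)] + [(1-a)/(1-b)]` for `a, 1-a, b, 1-b, a-b` units. -/
noncomputable def pbRel (R : Type) [CommRing R] : AddSubgroup (Wt R →₀ ℤ) :=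
  AddSubgroup.closure
    {x | ∃ a b c d e : Wt R, IsUnit ((a : R) - (b : R)) ∧
      (c : R) = (b : R) * Ring.inverse (a : R) ∧
      (d : R) = (1 - Ring.inverse (a : R)) * Ring.inverse (1 - Ring.inverse (b : R)) ∧
      (e : R) = (1 - (a : R)) * Ring.inverse (1 - (b : R)) ∧
      x = Finsupp.single a 1 - Finsupp.single b 1 + Finsupp.single c 1
          - Finsupp.single d 1 + Finsupp.single e 1}

/-- The pre-Bloch group `𝔭(R)`. -/
abbrev pBloch (R : Type) [CommRing R] : Type := (Wt R →₀ ℤ) ⧸ pbRel R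

/-- The generator `[a]` of the pre-Bloch group. -/
noncomputable def pcl (R : Type) [CommRing R] (a : Wt R) : pBloch R :=
  QuotientAddGroup.mk (Finsupp.single a 1)

theorem tmulU_mul_left {R : Type} [CommRing R] (a b c : Rˣ) :
    tmulU R (a * b) c = tmulU R a c + tmulU R b c := by
  simp only [tmulU, ofMul_mul, TensorProduct.add_tmul]

theorem tmulU_mul_right {R : Type} [CommRing R] (a b c : Rˣ) :
    tmulU R a (b * c) = tmulU R a b + tmulU R a c := by
  simp only [tmulU, ofMul_mul, TensorProduct.tmul_add]

theorem tmulU_inv_left {R : Type} [CommRing R] (a b : Rˣ) :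
    tmulU R a⁻¹ b = -tmulU R a b := by
  simp only [tmulU, ofMul_inv, TensorProduct.neg_tmul]

/-- `a ⊗ (1 - a) + a⁻¹ ⊗ (1 - a⁻¹) = a ⊗ (-a)`, already in `R^× ⊗ R^×`. -/
theorem tmulU_add_tmulU_of_inverse {R : Type} [CommRing R] (a ainv : Wt R)
    (h : (ainv : R) = Ring.inverse (a : R)) :
    tmulU R a.2.1.unit a.2.2.unit + tmulU R ainv.2.1.unit ainv.2.2.unit =
      tmulU R a.2.1.unit (-a.2.1.unit) := by
  have hm : (a : R) * (ainv : R) = 1 := by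
    rw [h, Ring.mul_inverse_cancel _ a.2.1]
  have hinv : ainv.2.1.unit = a.2.1.unit⁻¹ := by
    apply eq_inv_of_mul_eq_one_right
    ext
    simpa using hm
  have hw : a.2.2.unit = ainv.2.2.unit * -a.2.1.unit := by
    ext
    simp only [Units.val_mul, Units.val_neg, IsUnit.unit_spec]
    linear_combination -hm
  rw [hw, hinv, tmulU_mul_right, tmulU_inv_left]
  abel

/-- The defect of additivity of `a ↦ a ⊗ (-a)` is symmetric. -/
theorem tmulU_mul_neg_mul {R : Type} [CommRing R] (a b : Rˣ) :
    tmulU R (a * b) (-(a * b)) =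
      tmulU R a (-a) + tmulU R b (-b) + (tmulU R a b + tmulU R b a) := by
  have h₁ : tmulU R a (-(a * b)) = tmulU R a (-a) + tmulU R a b := by
    rw [← tmulU_mul_right, neg_mul]
  have h₂ : tmulU R b (-(a * b)) = tmulU R b a + tmulU R b (-b) := by
    rw [← tmulU_mul_right, mul_neg]
  rw [tmulU_mul_left, h₁, h₂]
  abel

theorem clsS_tmulU_add_swap {R : Type} [CommRing R] (a b : Rˣ) :
    clsS R (tmulU R a b + tmulU R b a) = 0 :=
  (QuotientAddGroup.eq_zero_iff _).2 (AddSubgroup.subset_closure ⟨a, b, rfl⟩)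

theorem clsSb_tmulU_neg {R : Type} [CommRing R] (a : Rˣ) :
    clsSb R (tmulU R a (-a)) = 0 :=
  (QuotientAddGroup.eq_zero_iff _).2 (AddSubgroup.subset_closure ⟨a, rfl⟩)

/-- (i) For `a, 1-a ∈ R^×` the element `⟨a⟩ := [a] + [a⁻¹]` of `𝔭(R)`
satisfies `λ⟨a⟩ = a ⊗ (-a)` in `(R^× ⊗ R^×)_σ`; in particular `⟨a⟩ ∈ B'(R) = ker η`.
(ii) For `a, 1-a, b, 1-b, 1-ab ∈ R^×`, the element `⟨ab⟩ - ⟨a⟩ - ⟨b⟩` lies in the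
Bloch group `B(R) = ker λ`. -/
theorem stmt18 (R : Type) [CommRing R]
    (lam : pBloch R →+ Tsigma R)
    (hlam : ∀ x : Wt R, lam (pcl R x) = clsS R (tmulU R x.2.1.unit x.2.2.unit))
    (eta : pBloch R →+ Tsigmabar R)
    (heta : ∀ x : Wt R, eta (pcl R x) = clsSb R (tmulU R x.2.1.unit x.2.2.unit)) :
    (∀ a ainv : Wt R, (ainv : R) = Ring.inverse (a : R) →
        lam (pcl R a + pcl R ainv) = clsS R (tmulU R a.2.1.unit (-a.2.1.unit)) ∧
        pcl R a + pcl R ainv ∈ eta.ker) ∧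
    (∀ a b ab ainv binv abinv : Wt R,
        (ab : R) = (a : R) * (b : R) →
        (ainv : R) = Ring.inverse (a : R) →
        (binv : R) = Ring.inverse (b : R) →
        (abinv : R) = Ring.inverse (ab : R) →
        (pcl R ab + pcl R abinv) - (pcl R a + pcl R ainv) - (pcl R b + pcl R binv)
          ∈ lam.ker) := by
  have key : ∀ a ainv : Wt R, (ainv : R) = Ring.inverse (a : R) →
      lam (pcl R a + pcl R ainv) = clsS R (tmulU R a.2.1.unit (-a.2.1.unit)) := by
    intro a ainv h
    rw [map_add, hlam, hlam, ← map_add, tmulU_add_tmulU_of_inverse a ainv h]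
  refine ⟨fun a ainv h => ⟨key a ainv h, ?_⟩, ?_⟩
  · rw [AddMonoidHom.mem_ker, map_add, heta, heta, ← map_add,
      tmulU_add_tmulU_of_inverse a ainv h, clsSb_tmulU_neg]
  · intro a b ab ainv binv abinv hab ha hb habinv
    have hu : ab.2.1.unit = a.2.1.unit * b.2.1.unit := by
      ext
      simpa using hab
    rw [AddMonoidHom.mem_ker, map_sub, map_sub, key a ainv ha, key b binv hb,
      key ab abinv habinv, hu, tmulU_mul_neg_mul, map_add, map_add, clsS_tmulU_add_swap]
    abel
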